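/- arXiv:1802.08417 — 9 statements merged into one kernel-verified Lean document; each statement's English description precedes it below -/
import Mathlib

section
/- Let (Ω, P) be a probability space and let X : Ω → ℝ be a random variable satisfying the sub-Gaussian moment bound E[exp(X² / σ²)] ≤ 2 for some σ > 0. Then for every event A with P(A) > 0, ( E[X · 1_A] / P(A) )² ≤ σ² · log(2 / P(A)). -/
open MeasureTheory Real

/-- **Geometric Inequality II, one-dimensional case** (Lemma `geometry_2` in the paper).
If `X` is a real random variable on a probability space with sub-Gaussian moment
bound `E[exp(X²/σ²)] ≤ 2` for some `σ > 0`, then for every event `A` with positive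
probability, `(E[X · 1_A] / P(A))² ≤ σ² · log(2 / P(A))`. -/
theorem conditional_mean_sq_le_of_subGaussian
    {Ω : Type*} [MeasurableSpace Ω] (μ : Measure Ω) [IsProbabilityMeasure μ]
    (X : Ω → ℝ) (σ : ℝ) (hσ : 0 < σ)
    (hint : Integrable (fun ω => Real.exp (X ω ^ 2 / σ ^ 2)) μ)
    (hsub : ∫ ω, Real.exp (X ω ^ 2 / σ ^ 2) ∂μ ≤ 2)
    (A : Set Ω) (hA : MeasurableSet A) (hApos : 0 < μ A) :
    ((∫ ω in A, X ω ∂μ) / (μ A).toReal) ^ 2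
      ≤ σ ^ 2 * Real.log (2 / (μ A).toReal) := by
  have hp : 0 < (μ A).toReal := ENNReal.toReal_pos hApos.ne' (measure_ne_top μ A)
  have hp1 : (μ A).toReal ≤ 1 := by
    have := ENNReal.toReal_mono ENNReal.one_ne_top (prob_le_one (μ := μ) (s := A))
    simpa using this
  have hs2 : 0 < σ ^ 2 := by positivity
  by_cases hX : IntegrableOn X A μ
  · set p := (μ A).toReal with hpdef
    set m := (∫ ω in A, X ω ∂μ) / p with hm
    have hmp : ∫ ω in A, X ω ∂μ = m * p := by rw [hm]; field_simp
    have hpt : ∀ ω, Real.exp (m ^ 2 / σ ^ 2) * (1 + 2 * m / σ ^ 2 * (X ω - m))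
        ≤ Real.exp (X ω ^ 2 / σ ^ 2) := by
      intro ω
      have h1 : Real.exp (X ω ^ 2 / σ ^ 2)
          = Real.exp (m ^ 2 / σ ^ 2) * Real.exp ((X ω ^ 2 - m ^ 2) / σ ^ 2) := by
        rw [← Real.exp_add]; congr 1; ring
      rw [h1]
      refine mul_le_mul_of_nonneg_left ?_ (Real.exp_pos _).le
      have h2 := Real.add_one_le_exp ((X ω ^ 2 - m ^ 2) / σ ^ 2)
      have h3 : 2 * m / σ ^ 2 * (X ω - m) ≤ (X ω ^ 2 - m ^ 2) / σ ^ 2 := by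
        rw [div_mul_eq_mul_div]
        gcongr
        nlinarith [sq_nonneg (X ω - m)]
      linarith
    have hXm : Integrable (fun ω => 2 * m / σ ^ 2 * (X ω - m)) (μ.restrict A) :=
      (Integrable.sub hX (integrable_const m)).const_mul _
    have hI : ∫ ω in A, Real.exp (m ^ 2 / σ ^ 2) * (1 + 2 * m / σ ^ 2 * (X ω - m)) ∂μ
        = Real.exp (m ^ 2 / σ ^ 2) * p := by
      rw [integral_const_mul, integral_add (integrable_const _) hXm, integral_const_mul,
        integral_sub hX (integrable_const m), hmp]
      simp [Measure.real, ← hpdef, mul_comm]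
    have h4 : Real.exp (m ^ 2 / σ ^ 2) * p ≤ 2 := by
      rw [← hI]
      refine le_trans (integral_mono ?_ hint.integrableOn hpt) (le_trans ?_ hsub)
      · exact ((integrable_const _).add hXm).const_mul _
      · exact setIntegral_le_integral hint (Filter.Eventually.of_forall fun ω => (Real.exp_pos _).le)
    have h5 : m ^ 2 / σ ^ 2 ≤ Real.log (2 / p) := by
      rw [Real.le_log_iff_exp_le (by positivity), le_div_iff₀ hp]
      exact h4
    rw [div_le_iff₀ hs2] at h5
    linarith
  · rw [integral_undef hX]
    have : 0 ≤ Real.log (2 / (μ A).toReal) := by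
      apply Real.log_nonneg
      rw [le_div_iff₀ hp]
      linarith
    have h6 := mul_nonneg hs2.le this
    simpa using h6
end

section
/- Let (Ω, P) be a probability space and let S : Ω → ℝ^d be a random vector such that for every unit vector v ∈ ℝ^d one has E[exp(⟨v, S⟩² / σ²)] ≤ 2, for some σ > 0. Then for every event A with P(A) > 0, ‖ E[S · 1_A] / P(A) ‖₂² ≤ σ² · log(2 / P(A)). -/
open MeasureTheory Real

/-- **Geometric Inequality II, vector case** (Lemma `geometry_2` in the paper).
If `S` is a random vector in `ℝ^d` on a probability space such that every
one-dimensional projection `⟨v, S⟩` (for a unit vector `v`) satisfies the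
sub-Gaussian moment bound `E[exp(⟨v,S⟩²/σ²)] ≤ 2`, then for every event `A` with
positive probability, the squared Euclidean norm of the conditional mean vector
`E[S | A]` is at most `σ² · log(2 / P(A))`. -/
theorem conditional_mean_vector_sq_norm_le_of_subGaussian
    {Ω : Type*} [MeasurableSpace Ω] (μ : Measure Ω) [IsProbabilityMeasure μ]
    (d : ℕ) (S : Ω → Fin d → ℝ) (σ : ℝ) (hσ : 0 < σ)
    (hsub : ∀ v : Fin d → ℝ, ∑ i, (v i) ^ 2 = 1 →
      Integrable (fun ω => Real.exp ((∑ i, v i * S ω i) ^ 2 / σ ^ 2)) μ ∧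
      ∫ ω, Real.exp ((∑ i, v i * S ω i) ^ 2 / σ ^ 2) ∂μ ≤ 2)
    (A : Set Ω) (hA : MeasurableSet A) (hApos : 0 < μ A) :
    ∑ i, ((∫ ω in A, S ω i ∂μ) / (μ A).toReal) ^ 2
      ≤ σ ^ 2 * Real.log (2 / (μ A).toReal) := by
  have hp0 : 0 < (μ A).toReal := ENNReal.toReal_pos hApos.ne' (measure_ne_top μ A)
  have hp1 : (μ A).toReal ≤ 1 := by
    have := ENNReal.toReal_mono ENNReal.one_ne_top (prob_le_one (μ := μ) (s := A))
    simpa using this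
  set p := (μ A).toReal with hp
  set m : Fin d → ℝ := fun i => (∫ ω in A, S ω i ∂μ) / p with hm
  set N := ∑ i, (m i) ^ 2 with hN
  have hN0 : 0 ≤ N := Finset.sum_nonneg fun i _ => sq_nonneg _
  change N ≤ _
  rcases hN0.eq_or_lt with h0 | hNpos
  · rw [← h0]
    have : 0 ≤ Real.log (2 / p) := by
      apply Real.log_nonneg
      rw [le_div_iff₀ hp0]
      linarith
    positivity
  set r := Real.sqrt N with hr
  have hr0 : 0 < r := Real.sqrt_pos.2 hNpos
  have hrr : r ^ 2 = N := Real.sq_sqrt hN0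
  have hv : ∑ i, (m i / r) ^ 2 = 1 := by
    simp only [div_pow]
    rw [← Finset.sum_div, hrr, ← hN, div_self hNpos.ne']
  obtain ⟨hint, hle⟩ := hsub (fun i => m i / r) hv
  have hi : ∀ i ∈ Finset.univ, Integrable (fun ω => m i / r * S ω i) (μ.restrict A) := by
    intro i _
    by_cases h : Integrable (fun ω => S ω i) (μ.restrict A)
    · exact h.const_mul _
    · have : m i = 0 := by simp [hm, integral_undef h]
      simp [this]
  have hX : Integrable (fun ω => ∑ i, m i / r * S ω i) (μ.restrict A) :=
    integrable_finsetSum _ hi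
  have hXm : ∫ ω in A, (∑ i, m i / r * S ω i) ∂μ = p * r := by
    rw [integral_finsetSum _ hi]
    have : ∀ i, ∫ ω in A, m i / r * S ω i ∂μ = p / r * (m i) ^ 2 := by
      intro i
      rw [integral_const_mul]
      have : ∫ ω in A, S ω i ∂μ = p * m i := by
        simp only [hm]; field_simp
      rw [this]; ring
    simp only [this]
    rw [← Finset.mul_sum, ← hN, ← hrr]
    field_simp
  set c := N / σ ^ 2 with hc
  have hσ2 : 0 < σ ^ 2 := by positivity
  have hpt : ∀ x : ℝ, Real.exp c * (1 - 2 * c) + Real.exp c * (2 * r / σ ^ 2) * x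
      ≤ Real.exp (x ^ 2 / σ ^ 2) := by
    intro x
    have h1 := Real.add_one_le_exp (x ^ 2 / σ ^ 2 - c)
    have h2 : Real.exp (x ^ 2 / σ ^ 2) = Real.exp c * Real.exp (x ^ 2 / σ ^ 2 - c) := by
      rw [← Real.exp_add]; congr 1; ring
    rw [h2]
    have h3 : (1 - 2 * c) + (2 * r / σ ^ 2) * x ≤ x ^ 2 / σ ^ 2 - c + 1 := by
      have h4 : 0 ≤ (x - r) ^ 2 / σ ^ 2 := by positivity
      have h5 : (x - r) ^ 2 / σ ^ 2 = x ^ 2 / σ ^ 2 - (2 * r / σ ^ 2) * x + c := by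
        rw [hc, ← hrr]; ring
      linarith
    have := mul_le_mul_of_nonneg_left (h3.trans h1) (Real.exp_pos c).le
    linarith
  have hI1 : ∫ ω in A, (Real.exp c * (1 - 2 * c)
      + Real.exp c * (2 * r / σ ^ 2) * (∑ i, m i / r * S ω i)) ∂μ
      ≤ ∫ ω in A, Real.exp ((∑ i, m i / r * S ω i) ^ 2 / σ ^ 2) ∂μ :=
    integral_mono ((integrable_const _).add (hX.const_mul _)) hint.integrableOn
      (fun ω => hpt _)
  have hI2 : ∫ ω in A, Real.exp ((∑ i, m i / r * S ω i) ^ 2 / σ ^ 2) ∂μ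
      ≤ ∫ ω, Real.exp ((∑ i, m i / r * S ω i) ^ 2 / σ ^ 2) ∂μ :=
    setIntegral_le_integral hint (Filter.Eventually.of_forall fun ω => (Real.exp_pos _).le)
  rw [integral_add (integrable_const _) (hX.const_mul _), setIntegral_const,
    integral_const_mul, hXm, smul_eq_mul, measureReal_def, ← hp] at hI1
  have hI3 : p * (Real.exp c * (1 - 2 * c)) + Real.exp c * (2 * r / σ ^ 2) * (p * r)
      = Real.exp c * p := by
    rw [hc, ← hrr]; ring
  have hfin : Real.exp c * p ≤ 2 := by linarith
  have hcl : c ≤ Real.log (2 / p) := by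
    rw [Real.le_log_iff_exp_le (by positivity), le_div_iff₀ hp0]
    exact hfin
  rw [hc, div_le_iff₀ hσ2] at hcl
  linarith
end

section
/- Let μ be the standard Gaussian measure on ℝ^d, i.e., the d-fold product of the one-dimensional Gaussian measure N(0,1). Then for every measurable set A ⊆ ℝ^d with μ(A) > 0, ‖ (1/μ(A)) ∫_A x dμ(x) ‖₂² ≤ 2 · log(1 / μ(A)). -/
open MeasureTheory Real ProbabilityTheory

/-- **Geometric inequality for the Gaussian measure** (Lemma `geometry_gaussian`
in the paper). Let `μ` be the standard Gaussian measure on `ℝ^d` (the `d`-fold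
product of `N(0,1)`). For every measurable set `A` with `μ(A) > 0`, the squared
Euclidean norm of the conditional mean vector `(1/μ(A)) ∫_A x dμ(x)` is at most
`2 · log(1/μ(A))`. -/
theorem gaussian_conditional_mean_sq_norm_le
    (d : ℕ) (A : Set (Fin d → ℝ)) (hA : MeasurableSet A)
    (μ : Measure (Fin d → ℝ))
    (hμ : μ = Measure.pi fun _ : Fin d => gaussianReal 0 1)
    (hApos : 0 < μ A) :
    ∑ i, ((μ A).toReal⁻¹ * ∫ x in A, x i ∂μ) ^ 2
      ≤ 2 * Real.log (1 / (μ A).toReal) := by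
  subst hμ
  set μ : Measure (Fin d → ℝ) := Measure.pi fun _ : Fin d => gaussianReal 0 1 with hμ
  set p : ℝ := (μ A).toReal with hp
  have hp0 : 0 < p := ENNReal.toReal_pos hApos.ne' (measure_ne_top μ A)
  set v : Fin d → ℝ := fun i => p⁻¹ * ∫ x in A, x i ∂μ with hv
  change ∑ i, (v i) ^ 2 ≤ _
  set m : ℝ := ∑ i, (v i) ^ 2 with hm
  have hint : ∀ i, Integrable (fun x : Fin d → ℝ => x i) μ := by
    intro i
    have h1 : Integrable (id : ℝ → ℝ) (gaussianReal 0 1) :=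
      (memLp_id_gaussianReal' 1 (by simp)).integrable le_rfl
    exact (measurePreserving_eval (fun _ : Fin d => gaussianReal 0 1) i).integrable_comp_of_integrable h1
  have hexp_eq : ∀ x : Fin d → ℝ, rexp (∑ i, v i * x i) = ∏ i, rexp (v i * x i) :=
    fun x => Real.exp_sum _ _
  have hexp_int : Integrable (fun x : Fin d → ℝ => rexp (∑ i, v i * x i)) μ := by
    simp_rw [hexp_eq]
    exact Integrable.fintype_prod (f := fun i (y : ℝ) => rexp (v i * y))
      (fun i => integrable_exp_mul_gaussianReal (v i))
  have hexp_val : ∫ x, rexp (∑ i, v i * x i) ∂μ = rexp (m / 2) := by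
    simp_rw [hexp_eq]
    rw [hμ, integral_fintype_prod_eq_prod (f := fun i (y : ℝ) => rexp (v i * y))]
    have : ∀ t : ℝ, ∫ y, rexp (t * y) ∂(gaussianReal 0 1) = rexp (t ^ 2 / 2) := by
      intro t
      have := congrFun (mgf_id_gaussianReal (μ := 0) (v := 1)) t
      simpa [mgf] using this
    simp_rw [this]
    rw [← Real.exp_sum, ← Finset.sum_div]
  have hY : Integrable (fun x : Fin d → ℝ => ∑ i, v i * x i) μ :=
    integrable_finsetSum _ fun i _ => (hint i).const_mul _
  have hYA : ∫ x in A, (∑ i, v i * x i) ∂μ = p * m := by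
    rw [integral_finsetSum _ fun i _ => ((hint i).const_mul _).integrableOn]
    rw [hm, Finset.mul_sum]
    refine Finset.sum_congr rfl fun i _ => ?_
    rw [integral_const_mul]
    have : ∫ x in A, x i ∂μ = p * v i := by
      simp only [hv]; field_simp
    rw [this]; ring
  have hle1 : ∫ x in A, rexp (∑ i, v i * x i) ∂μ ≤ rexp (m / 2) := by
    rw [← hexp_val]
    exact setIntegral_le_integral hexp_int (Filter.Eventually.of_forall fun x => (Real.exp_pos _).le)
  have hle2 : rexp m * p ≤ ∫ x in A, rexp (∑ i, v i * x i) ∂μ := by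
    have hval : ∫ x in A, rexp m * ((∑ i, v i * x i) + (1 - m)) ∂μ = rexp m * p := by
      rw [integral_const_mul, integral_add hY.integrableOn (integrable_const _), hYA,
        setIntegral_const, smul_eq_mul, Measure.real, ← hp]
      ring
    rw [← hval]
    refine integral_mono ((hY.integrableOn.add (integrable_const _)).const_mul _)
      hexp_int.integrableOn fun x => ?_
    have h := Real.add_one_le_exp ((∑ i, v i * x i) - m)
    have h2 : rexp (∑ i, v i * x i) = rexp m * rexp ((∑ i, v i * x i) - m) := by
      rw [← Real.exp_add]; congr 1; ring
    simp only
    rw [h2]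
    exact mul_le_mul_of_nonneg_left (by linarith) (Real.exp_pos _).le
  have h3 := Real.log_le_log (by positivity) (hle2.trans hle1)
  rw [Real.log_mul (Real.exp_pos _).ne' hp0.ne', Real.log_exp, Real.log_exp] at h3
  rw [one_div, Real.log_inv]
  linarith
end

section
/- Let X be uniformly distributed on the hypercube {−1, 1}^d and let a : {−1,1}^d → [0,1] be a function with E[a(X)] > 0. Then ‖ E[X · a(X)] / E[a(X)] ‖₂² ≤ 2 · log(1 / E[a(X)]). Moreover, the dimension-free constant 2 in this inequality cannot be improved. -/
open Real Finset

/-- The vertex of the hypercube `{-1,1}^d` encoded by a Boolean vector. -/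
noncomputable def hypercubeVec {d : ℕ} (s : Fin d → Bool) : Fin d → ℝ :=
  fun i => if s i then 1 else -1


lemma hc_sum_exp (d : ℕ) (u : Fin d → ℝ) :
    ∑ s : Fin d → Bool, Real.exp (∑ i, u i * hypercubeVec s i)
      ≤ 2 ^ d * Real.exp ((∑ i, u i ^ 2) / 2) := by
  have h1 : ∑ s : Fin d → Bool, Real.exp (∑ i, u i * hypercubeVec s i)
      = ∏ i, (2 * Real.cosh (u i)) := by
    have h2 : ∀ i, 2 * Real.cosh (u i)
        = ∑ b : Bool, Real.exp (u i * (if b then 1 else -1)) := by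
      intro i
      rw [Fintype.sum_bool, Real.cosh_eq]
      simp
      ring
    simp_rw [h2]
    rw [Fintype.prod_sum]
    refine Finset.sum_congr rfl fun s _ => ?_
    rw [Real.exp_sum]
    rfl
  rw [h1, Finset.prod_mul_distrib]
  simp only [Finset.prod_const, Finset.card_univ, Fintype.card_fin]
  gcongr
  rw [Finset.sum_div, Real.exp_sum]
  exact Finset.prod_le_prod (fun i _ => (Real.cosh_pos _).le)
    (fun i _ => Real.cosh_le_exp_half_sq _)

lemma hc_upper (d : ℕ) (a : (Fin d → Bool) → ℝ) (ha : ∀ s, 0 ≤ a s ∧ a s ≤ 1)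
    (hp : 0 < (2 ^ d : ℝ)⁻¹ * ∑ s, a s) :
    ∑ i, (((2 ^ d : ℝ)⁻¹ * ∑ s, hypercubeVec s i * a s) /
            ((2 ^ d : ℝ)⁻¹ * ∑ s, a s)) ^ 2
        ≤ 2 * Real.log (1 / ((2 ^ d : ℝ)⁻¹ * ∑ s, a s)) := by
  set m := (2 ^ d : ℝ)⁻¹ * ∑ s, a s with hm
  set u : Fin d → ℝ := fun i => ((2 ^ d : ℝ)⁻¹ * ∑ s, hypercubeVec s i * a s) / m with hu
  set b := ∑ i, u i ^ 2 with hb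
  change b ≤ _
  have hA : ∑ s, a s = 2 ^ d * m := by rw [hm]; field_simp
  have hX : ∀ i, ∑ s, hypercubeVec s i * a s = u i * (2 ^ d * m) := by
    intro i; simp only [hu]; field_simp
  have h1 : ∑ s, a s * (Real.exp b * (1 + ((∑ i, u i * hypercubeVec s i) - b)))
      ≤ ∑ s : Fin d → Bool, Real.exp (∑ i, u i * hypercubeVec s i) := by
    refine Finset.sum_le_sum fun s _ => ?_
    have e1 : Real.exp b * (1 + ((∑ i, u i * hypercubeVec s i) - b))
        ≤ Real.exp (∑ i, u i * hypercubeVec s i) := by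
      calc _ ≤ Real.exp b * Real.exp ((∑ i, u i * hypercubeVec s i) - b) := by
            gcongr
            linarith [Real.add_one_le_exp ((∑ i, u i * hypercubeVec s i) - b)]
        _ = _ := by rw [← Real.exp_add]; congr 1; ring
    calc _ ≤ a s * Real.exp (∑ i, u i * hypercubeVec s i) :=
          mul_le_mul_of_nonneg_left e1 (ha s).1
      _ ≤ 1 * Real.exp (∑ i, u i * hypercubeVec s i) :=
          mul_le_mul_of_nonneg_right (ha s).2 (Real.exp_pos _).le
      _ = _ := one_mul _
  have h2 : ∑ s, a s * (Real.exp b * (1 + ((∑ i, u i * hypercubeVec s i) - b)))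
      = Real.exp b * (2 ^ d * m) := by
    have h3 : ∑ s, a s * ∑ i, u i * hypercubeVec s i = b * (2 ^ d * m) := by
      simp_rw [Finset.mul_sum]
      rw [Finset.sum_comm, hb, Finset.sum_mul]
      refine Finset.sum_congr rfl fun i _ => ?_
      rw [pow_two, mul_assoc, ← hX i, Finset.mul_sum]
      exact Finset.sum_congr rfl fun s _ => by ring
    calc _ = Real.exp b * ((1 - b) * ∑ s, a s + ∑ s, a s * ∑ i, u i * hypercubeVec s i) := by
          rw [Finset.mul_sum, ← Finset.sum_add_distrib, Finset.mul_sum]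
          exact Finset.sum_congr rfl fun s _ => by ring
      _ = _ := by rw [h3, hA]; ring
  have h4 := hc_sum_exp d u
  rw [h2] at h1
  have h5 : Real.exp b * m ≤ Real.exp (b / 2) := by
    have h6 := h1.trans h4
    have h7 : (2:ℝ) ^ d * (Real.exp b * m) ≤ 2 ^ d * Real.exp (b / 2) := by linarith
    exact le_of_mul_le_mul_left h7 (by positivity)
  have h8 := Real.log_le_log (by positivity) h5
  rw [Real.log_mul (Real.exp_pos _).ne' hp.ne', Real.log_exp, Real.log_exp] at h8
  rw [one_div, Real.log_inv]
  linarith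

lemma hc_choose (n J : ℕ) (hJ : J < n) : ∀ j, j ≤ J →
    Real.log ((2 * n).choose n) - (j : ℝ) ^ 2 / ((n : ℝ) - J)
      ≤ Real.log ((2 * n).choose (n + j)) := by
  have hnJ : (0:ℝ) < (n : ℝ) - J := by
    have : (J : ℝ) < n := by exact_mod_cast hJ
    linarith
  intro j
  induction j with
  | zero => intro _; simp
  | succ j ih =>
    intro hj
    have ih := ih (by omega)
    have hjJ : (j : ℝ) + 1 ≤ J := by exact_mod_cast hj
    have e := Nat.choose_succ_right_eq (2 * n) (n + j)
    have e2 : 2 * n - (n + j) = n - j := by omega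
    rw [e2] at e
    have e3 : (((2 * n).choose (n + j + 1) : ℕ) : ℝ) * ((n : ℝ) + j + 1)
        = ((2 * n).choose (n + j) : ℕ) * ((n : ℝ) - j) := by
      have := congrArg (Nat.cast : ℕ → ℝ) e
      push_cast [Nat.cast_sub (show j ≤ n by omega)] at this
      exact this
    have p1 : (0:ℝ) < ((2 * n).choose (n + j + 1) : ℕ) := by
      exact_mod_cast Nat.choose_pos (by omega)
    have p2 : (0:ℝ) < ((2 * n).choose (n + j) : ℕ) := by
      exact_mod_cast Nat.choose_pos (by omega)
    have p3 : (0:ℝ) < (n : ℝ) - j := by linarith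
    have p4 : (0:ℝ) < (n : ℝ) + j + 1 := by positivity
    have e4 := congrArg Real.log e3
    rw [Real.log_mul p1.ne' p4.ne', Real.log_mul p2.ne' p3.ne'] at e4
    have l1 : Real.log ((n : ℝ) + j + 1) - Real.log ((n : ℝ) - j)
        ≤ (2 * j + 1) / ((n : ℝ) - J) := by
      rw [← Real.log_div p4.ne' p3.ne']
      have := Real.log_le_sub_one_of_pos (div_pos p4 p3)
      have q : ((n : ℝ) + j + 1) / ((n : ℝ) - j) - 1 = (2 * j + 1) / ((n : ℝ) - j) := by
        field_simp; ring
      rw [q] at this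
      refine this.trans ?_
      gcongr
      linarith
    have q2 : ((j + 1 : ℕ) : ℝ) ^ 2 / ((n : ℝ) - J)
        = (j : ℝ) ^ 2 / ((n : ℝ) - J) + (2 * j + 1) / ((n : ℝ) - J) := by
      push_cast; ring
    rw [q2, ← add_assoc]
    linarith

lemma hc_card (d k : ℕ) :
    ∑ s : Fin d → Bool, (if (Finset.univ.filter fun i => s i = true).card = k then (1:ℝ) else 0)
      = d.choose k := by
  rw [Finset.sum_boole]
  have h : (Finset.univ.filter fun s : Fin d → Bool =>
      (Finset.univ.filter fun i => s i = true).card = k).card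
      = (Finset.powersetCard k (Finset.univ : Finset (Fin d))).card := by
    refine Finset.card_nbij' (fun s => Finset.univ.filter fun i => s i = true)
      (fun t i => decide (i ∈ t)) ?_ ?_ ?_ ?_
    · intro s hs; simpa [Finset.mem_powersetCard] using hs
    · intro t ht; simpa [Finset.mem_powersetCard] using ht
    · intro s _; ext i; simp
    · intro t _; ext i; simp
  rw [h]; simp

lemma hc_coord_sum (d : ℕ) (s : Fin d → Bool) :
    ∑ i, hypercubeVec s i = 2 * ((Finset.univ.filter fun i => s i = true).card : ℝ) - d := by
  have : ∀ i, hypercubeVec s i = 2 * (if s i = true then (1:ℝ) else 0) - 1 := by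
    intro i; unfold hypercubeVec; split_ifs <;> norm_num
  simp_rw [this]
  rw [Finset.sum_sub_distrib, ← Finset.mul_sum, Finset.sum_boole]
  simp

lemma hc_lower (c : ℝ) (hc : c < 2) : ∃ (d : ℕ) (a : (Fin d → Bool) → ℝ),
      (∀ s, 0 ≤ a s ∧ a s ≤ 1) ∧
      0 < (2 ^ d : ℝ)⁻¹ * ∑ s, a s ∧
      c * Real.log (1 / ((2 ^ d : ℝ)⁻¹ * ∑ s, a s)) <
        ∑ i, (((2 ^ d : ℝ)⁻¹ * ∑ s, hypercubeVec s i * a s) /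
              ((2 ^ d : ℝ)⁻¹ * ∑ s, a s)) ^ 2 := by
  obtain ⟨r, hr⟩ := exists_nat_gt (max 2 (18 / (2 - c)))
  have hr2 : (2:ℝ) < r := lt_of_le_of_lt (le_max_left _ _) hr
  have hr3 : 18 / (2 - c) < r := lt_of_le_of_lt (le_max_right _ _) hr
  have hrn : 2 < r := by exact_mod_cast hr2
  have hr4 : 18 < r * (2 - c) := (div_lt_iff₀ (by linarith)).1 hr3
  obtain ⟨n, hn⟩ : ∃ n, n = r ^ 6 := ⟨_, rfl⟩
  obtain ⟨j, hj⟩ : ∃ j, j = r ^ 4 := ⟨_, rfl⟩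
  have hjn : j < n := by rw [hn, hj]; exact Nat.pow_lt_pow_right (by omega) (by norm_num)
  have hn0 : 0 < n := by omega
  have hnr : (n : ℝ) = (r : ℝ) ^ 6 := by rw [hn]; push_cast; rfl
  have hjr : (j : ℝ) = (r : ℝ) ^ 4 := by rw [hj]; push_cast; rfl
  have hnpos : (0:ℝ) < n := by exact_mod_cast hn0
  let a : (Fin (2 * n) → Bool) → ℝ :=
    fun s => if (Finset.univ.filter fun i => s i = true).card = n + j then (1:ℝ) else 0
  have hsum : ∑ s, a s = (2 * n).choose (n + j) := hc_card _ _
  have hC : (0:ℝ) < ((2 * n).choose (n + j) : ℕ) := by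
    exact_mod_cast Nat.choose_pos (by omega)
  have ha : ∀ s, 0 ≤ a s ∧ a s ≤ 1 := by
    intro s; simp only [a]; split_ifs <;> norm_num
  have hm : 0 < (2 ^ (2 * n) : ℝ)⁻¹ * ∑ s, a s := by rw [hsum]; positivity
  refine ⟨2 * n, a, ha, hm, ?_⟩
  -- log bound
  have hlog : Real.log (1 / ((2 ^ (2 * n) : ℝ)⁻¹ * ∑ s, a s)) ≤ (r:ℝ) ^ 2 + 9 * r := by
    rw [hsum, one_div, Real.log_inv, Real.log_mul (by positivity) hC.ne', Real.log_inv]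
    have h1 := hc_choose n j hjn j le_rfl
    have h2 : ((2:ℝ) ^ (2 * n)) ≤ (2 * n : ℝ) * ((2 * n).choose n : ℕ) := by
      have := Nat.four_pow_le_two_mul_self_mul_centralBinom n hn0
      rw [Nat.centralBinom] at this
      rw [pow_mul]; norm_num
      exact_mod_cast this
    have hC0 : (0:ℝ) < ((2 * n).choose n : ℕ) := by
      exact_mod_cast Nat.choose_pos (by omega)
    have h3 := Real.log_le_log (by positivity) h2
    rw [Real.log_mul (by positivity) hC0.ne', Real.log_mul (by norm_num) hnpos.ne'] at h3
    have h4 : Real.log (n : ℝ) ≤ 6 * ((r : ℝ) - 1) := by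
      rw [hnr, Real.log_pow]
      have := Real.log_le_sub_one_of_pos (show (0:ℝ) < r by linarith)
      push_cast; linarith
    have h5 : Real.log 2 ≤ 1 := by
      have := Real.log_le_sub_one_of_pos (show (0:ℝ) < 2 by norm_num); linarith
    have h6 : (j : ℝ) ^ 2 / ((n : ℝ) - j) ≤ (r:ℝ) ^ 2 + 2 := by
      rw [hnr, hjr]
      have hq : (4:ℝ) ≤ r ^ 2 := by nlinarith
      have : (r:ℝ) ^ 6 - r ^ 4 = r ^ 4 * (r ^ 2 - 1) := by ring
      rw [this, div_le_iff₀ (mul_pos (by positivity) (by linarith))]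
      have h7 : ((r:ℝ) ^ 4) ^ 2 = r ^ 4 * (r ^ 2 * r ^ 2) := by ring
      have h8 : ((r:ℝ) ^ 2 + 2) * (r ^ 4 * (r ^ 2 - 1))
        = r ^ 4 * (r ^ 2 * r ^ 2 + (r ^ 2 - 2)) := by ring
      rw [h7, h8]
      gcongr
      linarith
    linarith
  have hlog0 : 0 ≤ Real.log (1 / ((2 ^ (2 * n) : ℝ)⁻¹ * ∑ s, a s)) := by
    have := hc_upper (2 * n) a ha hm
    have h0 : (0:ℝ) ≤ ∑ i, (((2 ^ (2 * n) : ℝ)⁻¹ * ∑ s, hypercubeVec s i * a s) /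
              ((2 ^ (2 * n) : ℝ)⁻¹ * ∑ s, a s)) ^ 2 :=
      Finset.sum_nonneg fun i _ => sq_nonneg _
    linarith
  -- norm bound
  have hnorm : 2 * (r:ℝ) ^ 2 ≤ ∑ i, (((2 ^ (2 * n) : ℝ)⁻¹ * ∑ s, hypercubeVec s i * a s) /
              ((2 ^ (2 * n) : ℝ)⁻¹ * ∑ s, a s)) ^ 2 := by
    have cs := sq_sum_le_card_mul_sum_sq (s := (Finset.univ : Finset (Fin (2 * n))))
      (f := fun i => ((2 ^ (2 * n) : ℝ)⁻¹ * ∑ s, hypercubeVec s i * a s) /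
              ((2 ^ (2 * n) : ℝ)⁻¹ * ∑ s, a s))
    have hs : ∑ i, ((2 ^ (2 * n) : ℝ)⁻¹ * ∑ s, hypercubeVec s i * a s) /
              ((2 ^ (2 * n) : ℝ)⁻¹ * ∑ s, a s) = 2 * j := by
      rw [← Finset.sum_div, ← Finset.mul_sum, Finset.sum_comm, div_eq_iff hm.ne']
      have : ∑ s, ∑ i, hypercubeVec s i * a s = 2 * j * ∑ s, a s := by
        rw [Finset.mul_sum]
        refine Finset.sum_congr rfl fun s _ => ?_
        rw [← Finset.sum_mul, hc_coord_sum]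
        simp only [a]
        split_ifs with h
        · rw [h]; push_cast; ring
        · simp
      rw [this]; ring
    rw [hs] at cs
    simp only [Finset.card_univ, Fintype.card_fin] at cs
    push_cast at cs
    have h2n : (0:ℝ) < 2 * n := by positivity
    refine le_of_mul_le_mul_left (le_trans (le_of_eq ?_) cs) h2n
    rw [hnr, hjr]; ring
  refine lt_of_lt_of_le ?_ hnorm
  rcases le_or_gt c 0 with h | h
  · have := mul_nonneg (neg_nonneg.2 h) hlog0
    nlinarith
  · have := mul_le_mul_of_nonneg_left hlog h.le
    nlinarith

/-- **Geometric inequality on the binary hypercube** (Lemma `hamming` in the paper).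
For `X` uniform on `{−1,1}^d` and any weight function `a : {−1,1}^d → [0,1]` with
`E[a(X)] > 0`, the squared Euclidean norm of `E[X·a(X)] / E[a(X)]` is at most
`2 · log(1/E[a(X)])`. Moreover, the dimension-free constant `2` cannot be improved:
for every `c < 2` there are a dimension `d` and a weight function violating the
inequality with `2` replaced by `c`. -/
theorem hypercube_weighted_mean_sq_norm_le_and_constant_optimal :
    (∀ (d : ℕ) (a : (Fin d → Bool) → ℝ),
      (∀ s, 0 ≤ a s ∧ a s ≤ 1) →
      0 < (2 ^ d : ℝ)⁻¹ * ∑ s, a s →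
      ∑ i, (((2 ^ d : ℝ)⁻¹ * ∑ s, hypercubeVec s i * a s) /
            ((2 ^ d : ℝ)⁻¹ * ∑ s, a s)) ^ 2
        ≤ 2 * Real.log (1 / ((2 ^ d : ℝ)⁻¹ * ∑ s, a s))) ∧
    (∀ c : ℝ, c < 2 → ∃ (d : ℕ) (a : (Fin d → Bool) → ℝ),
      (∀ s, 0 ≤ a s ∧ a s ≤ 1) ∧
      0 < (2 ^ d : ℝ)⁻¹ * ∑ s, a s ∧
      c * Real.log (1 / ((2 ^ d : ℝ)⁻¹ * ∑ s, a s)) <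
        ∑ i, (((2 ^ d : ℝ)⁻¹ * ∑ s, hypercubeVec s i * a s) /
              ((2 ^ d : ℝ)⁻¹ * ∑ s, a s)) ^ 2) := by
  exact ⟨hc_upper, hc_lower⟩
end

section
/- For every d ≥ 1, the maximum over all subsets A ⊆ {−1,1}^d of cardinality |A| = 2^{d−1} of the Euclidean norm ‖ (1/|A|) ∑_{v ∈ A} v ‖₂ equals 1. That is: (i) for every A ⊆ {−1,1}^d with |A| = 2^{d−1}, one has ‖ (1/|A|) ∑_{v ∈ A} v ‖₂ ≤ 1; and (ii) the half-cube A = { x ∈ {−1,1}^d : x₁ = 1 } has |A| = 2^{d−1} and attains ‖ (1/|A|) ∑_{v ∈ A} v ‖₂ = 1. -/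
open Real Finset

theorem hv_sum_flip {d : ℕ} (i : Fin d) (F : (Fin d → Bool) → ℝ)
    (hF : ∀ v, F (Function.update v i (!v i)) = - F v) : ∑ v, F v = 0 := by
  have hinv : Function.Involutive (fun v : Fin d → Bool => Function.update v i (!v i)) := by
    intro v
    simp
  have h := Equiv.sum_comp (Function.Involutive.toPerm _ hinv) F
  have h2 : ∑ v, F (Function.Involutive.toPerm _ hinv v) = ∑ v, - F v :=
    Finset.sum_congr rfl (fun v _ => hF v)
  rw [h2, Finset.sum_neg_distrib] at h
  linarith

theorem hv_update_self {d : ℕ} (i : Fin d) (v : Fin d → Bool) :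
    hypercubeVec (Function.update v i (!v i)) i = - hypercubeVec v i := by
  unfold hypercubeVec
  cases h : v i <;> simp

theorem hv_update_ne {d : ℕ} (i j : Fin d) (hij : j ≠ i) (v : Fin d → Bool) :
    hypercubeVec (Function.update v i (!v i)) j = hypercubeVec v j := by
  unfold hypercubeVec
  simp [hij]

theorem hv_sum {d : ℕ} (i : Fin d) : ∑ v : Fin d → Bool, hypercubeVec v i = 0 :=
  hv_sum_flip i _ (hv_update_self i)

theorem hv_mul_self {d : ℕ} (i : Fin d) (v : Fin d → Bool) :
    hypercubeVec v i * hypercubeVec v i = 1 := by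
  unfold hypercubeVec
  cases h : v i <;> simp

theorem hv_orth {d : ℕ} (i j : Fin d) :
    ∑ v : Fin d → Bool, hypercubeVec v i * hypercubeVec v j = if i = j then 2 ^ d else 0 := by
  split_ifs with h
  · subst h
    simp [hv_mul_self]
  · apply hv_sum_flip i
    intro v
    rw [hv_update_self, hv_update_ne i j (Ne.symm h)]
    ring

theorem hv_bound {d : ℕ} (hd : 1 ≤ d) (A : Finset (Fin d → Bool)) (hA : A.card = 2 ^ (d - 1)) :
    ∑ i, ((A.card : ℝ)⁻¹ * ∑ v ∈ A, hypercubeVec v i) ^ 2 ≤ 1 := by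
  set a : Fin d → ℝ := fun i => (A.card : ℝ)⁻¹ * ∑ v ∈ A, hypercubeVec v i with ha
  have hN : (0 : ℝ) < A.card := by rw [hA]; positivity
  have h2N : (2 : ℝ) ^ d = 2 * A.card := by
    rw [hA]; push_cast
    rw [← pow_succ', Nat.sub_add_cancel hd]
  have haA : ∀ i, ∑ v ∈ A, hypercubeVec v i = A.card * a i := by
    intro i
    simp only [ha]
    field_simp
  let g : (Fin d → Bool) → ℝ := fun v => if v ∈ A then 1 else -1
  have hg2 : ∀ v, g v * g v = 1 := by
    intro v
    simp only [g]
    split_ifs <;> norm_num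
  have hg : ∀ i, ∑ v, g v * hypercubeVec v i = 2 * A.card * a i := by
    intro i
    have h1 : ∀ v, g v * hypercubeVec v i
        = 2 * (if v ∈ A then hypercubeVec v i else 0) - hypercubeVec v i := by
      intro v
      simp only [g]
      split_ifs <;> ring
    rw [Finset.sum_congr rfl (fun v _ => h1 v), Finset.sum_sub_distrib, hv_sum,
      ← Finset.mul_sum, Finset.sum_ite_mem, Finset.univ_inter, haA]
    ring
  let f : (Fin d → Bool) → ℝ := fun v => ∑ i, a i * hypercubeVec v i
  have hgf : ∑ v, g v * f v = 2 * A.card * ∑ i, a i ^ 2 := by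
    simp only [f, Finset.mul_sum]
    rw [Finset.sum_comm]
    refine Finset.sum_congr rfl (fun i _ => ?_)
    calc ∑ v, g v * (a i * hypercubeVec v i) = a i * ∑ v, g v * hypercubeVec v i := by
          rw [Finset.mul_sum]
          exact Finset.sum_congr rfl (fun v _ => by ring)
      _ = 2 * A.card * a i ^ 2 := by rw [hg]; ring
  have hvf : ∀ i, ∑ v, hypercubeVec v i * f v = 2 * A.card * a i := by
    intro i
    simp only [f, Finset.mul_sum]
    rw [Finset.sum_comm]
    calc ∑ j, ∑ v, hypercubeVec v i * (a j * hypercubeVec v j)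
        = ∑ j, a j * ∑ v, hypercubeVec v i * hypercubeVec v j := by
          refine Finset.sum_congr rfl (fun j _ => ?_)
          rw [Finset.mul_sum]
          exact Finset.sum_congr rfl (fun v _ => by ring)
      _ = 2 * A.card * a i := by
          simp only [hv_orth]
          simp [h2N]
          ring
  have hff : ∑ v, f v * f v = 2 * A.card * ∑ i, a i ^ 2 := by
    calc ∑ v, f v * f v = ∑ v, ∑ i, a i * (hypercubeVec v i * f v) := by
          refine Finset.sum_congr rfl (fun v _ => ?_)
          conv_lhs => arg 1; simp only [f]
          rw [Finset.sum_mul]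
          exact Finset.sum_congr rfl (fun i _ => by ring)
      _ = ∑ i, a i * ∑ v, hypercubeVec v i * f v := by
          rw [Finset.sum_comm]
          simp only [Finset.mul_sum]
      _ = 2 * A.card * ∑ i, a i ^ 2 := by
          rw [Finset.mul_sum]
          exact Finset.sum_congr rfl (fun i _ => by rw [hvf]; ring)
  have hgg : ∑ v, g v * g v = 2 * A.card := by
    simp only [hg2]
    simp [h2N]
  have hpos : 0 ≤ ∑ v, (g v - f v) ^ 2 := Finset.sum_nonneg (fun v _ => sq_nonneg _)
  have hexp : ∑ v, (g v - f v) ^ 2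
      = ∑ v, g v * g v - 2 * ∑ v, g v * f v + ∑ v, f v * f v := by
    rw [Finset.mul_sum, ← Finset.sum_sub_distrib, ← Finset.sum_add_distrib]
    exact Finset.sum_congr rfl (fun v _ => by ring)
  rw [hexp, hgg, hgf, hff] at hpos
  show ∑ i, a i ^ 2 ≤ 1
  by_contra hc
  push Not at hc
  nlinarith [mul_pos hN (sub_pos.mpr hc)]

theorem hv_half {d : ℕ} (k : Fin d) (F : (Fin d → Bool) → ℝ) :
    ∑ v ∈ Finset.univ.filter (fun x : Fin d → Bool => x k = true), F v
      = (∑ v, F v + ∑ v, hypercubeVec v k * F v) / 2 := by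
  rw [Finset.sum_filter, ← Finset.sum_add_distrib, Finset.sum_div]
  refine Finset.sum_congr rfl (fun v _ => ?_)
  unfold hypercubeVec
  split_ifs <;> ring

theorem hv_half_card {d : ℕ} (hd : 1 ≤ d) (k : Fin d) :
    (Finset.univ.filter (fun x : Fin d → Bool => x k = true)).card = 2 ^ (d - 1) := by
  have h := hv_half k (fun _ => 1)
  have h2 : (2 : ℝ) ^ d = 2 * 2 ^ (d - 1) := by
    rw [← pow_succ', Nat.sub_add_cancel hd]
  simp only [mul_one, hv_sum] at h
  simp [h2] at h
  exact_mod_cast h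

/-- **First part of Proposition `geometry`**: among all subsets `A ⊆ {−1,1}^d` of
cardinality `2^{d−1}`, the maximal Euclidean norm of the mean vector
`(1/|A|) ∑_{v∈A} v` equals `1`: every such subset has mean vector of norm at
most `1`, and the half-cube `{x : x₁ = 1}` has cardinality `2^{d-1}` and attains
norm exactly `1`. -/
theorem half_density_subset_mean_norm_max (d : ℕ) (hd : 1 ≤ d) :
    (∀ A : Finset (Fin d → Bool), A.card = 2 ^ (d - 1) →
      Real.sqrt (∑ i, ((A.card : ℝ)⁻¹ * ∑ v ∈ A, hypercubeVec v i) ^ 2) ≤ 1) ∧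
    ((Finset.univ.filter fun x : Fin d → Bool => x ⟨0, hd⟩ = true).card = 2 ^ (d - 1) ∧
      Real.sqrt (∑ i,
        (((Finset.univ.filter fun x : Fin d → Bool => x ⟨0, hd⟩ = true).card : ℝ)⁻¹ *
          ∑ v ∈ Finset.univ.filter fun x : Fin d → Bool => x ⟨0, hd⟩ = true,
            hypercubeVec v i) ^ 2) = 1) := by
  refine ⟨fun A hA => ?_, hv_half_card hd _, ?_⟩
  · rw [Real.sqrt_le_one]
    exact hv_bound hd A hA
  · rw [Real.sqrt_eq_one, hv_half_card hd]
    have h2 : (2 : ℝ) ^ d = 2 * 2 ^ (d - 1) := by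
      rw [← pow_succ', Nat.sub_add_cancel hd]
    have h : ∀ i, ((((2 ^ (d - 1) : ℕ) : ℝ))⁻¹ *
        ∑ v ∈ Finset.univ.filter (fun x : Fin d → Bool => x ⟨0, hd⟩ = true),
          hypercubeVec v i) ^ 2 = if (⟨0, hd⟩ : Fin d) = i then 1 else 0 := by
      intro i
      rw [hv_half, hv_sum, hv_orth, h2]
      split_ifs <;> simp
    simp only [h]
    simp
end

section
/- For every d ≥ 1 and every nonempty subset A ⊆ {−1,1}^d, the mean vector of A satisfies ‖ (1/|A|) ∑_{v ∈ A} v ‖₂² ≤ 2 · log( 2^d / |A| ). -/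
open Real Finset

/-- **Hypercube geometric inequality, indicator case**: for every `d ≥ 1` and every
nonempty `A ⊆ {−1,1}^d`, the mean vector of `A` satisfies
`‖(1/|A|) ∑_{v∈A} v‖₂² ≤ 2 · log(2^d / |A|)`. -/
theorem subset_mean_sq_norm_le (d : ℕ) (hd : 1 ≤ d)
    (A : Finset (Fin d → Bool)) (hA : A.Nonempty) :
    ∑ i, ((A.card : ℝ)⁻¹ * ∑ v ∈ A, hypercubeVec v i) ^ 2
      ≤ 2 * Real.log ((2 ^ d : ℝ) / (A.card : ℝ)) := by
  set n : ℝ := (A.card : ℝ) with hn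
  have hnpos : 0 < n := by simpa [hn] using hA
  set m : Fin d → ℝ := fun i => n⁻¹ * ∑ v ∈ A, hypercubeVec v i with hm
  have hS : ∑ i, (n⁻¹ * ∑ v ∈ A, hypercubeVec v i) ^ 2
      = ∑ v ∈ A, n⁻¹ * ∑ i, m i * hypercubeVec v i := by
    rw [← Finset.mul_sum, Finset.sum_comm, Finset.mul_sum]
    refine Finset.sum_congr rfl fun i _ => ?_
    rw [← Finset.mul_sum]
    simp only [hm]
    ring
  have hS' : ∑ i, (n⁻¹ * ∑ v ∈ A, hypercubeVec v i) ^ 2 = ∑ i, m i ^ 2 := rfl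
  rw [hS'] at hS ⊢
  set S : ℝ := ∑ i, m i ^ 2 with hSdef
  have h1 : Real.exp S ≤ ∑ v ∈ A, n⁻¹ * Real.exp (∑ i, m i * hypercubeVec v i) := by
    rw [hS]
    have := convexOn_exp.map_sum_le (t := A) (w := fun _ => n⁻¹)
      (p := fun v => ∑ i, m i * hypercubeVec v i)
      (fun _ _ => by positivity) (by simp [← hn, hnpos.ne']) (fun _ _ => Set.mem_univ _)
    simpa only [smul_eq_mul] using this
  have h2 : ∑ v : Fin d → Bool, Real.exp (∑ i, m i * hypercubeVec v i)
      = ∏ i, (2 * Real.cosh (m i)) := by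
    have := Finset.prod_univ_sum (fun _ : Fin d => (Finset.univ : Finset Bool))
      (fun i b => Real.exp (m i * (if b then (1 : ℝ) else -1)))
    rw [Fintype.piFinset_univ] at this
    simp only [Real.exp_sum, hypercubeVec]
    rw [← this]
    refine Finset.prod_congr rfl fun i _ => ?_
    rw [Real.cosh_eq]
    simp
    ring
  have h3 : ∏ i, (2 * Real.cosh (m i)) ≤ 2 ^ d * Real.exp (S / 2) := by
    rw [Finset.prod_mul_distrib, hSdef, Finset.sum_div, Real.exp_sum]
    simp only [Finset.prod_const, Finset.card_univ, Fintype.card_fin]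
    gcongr with i _
    exact Real.cosh_le_exp_half_sq _
  have h4 : Real.exp S ≤ (2 ^ d / n) * Real.exp (S / 2) := by
    rw [← Finset.mul_sum] at h1
    have h5 : ∑ v ∈ A, Real.exp (∑ i, m i * hypercubeVec v i)
        ≤ ∑ v : Fin d → Bool, Real.exp (∑ i, m i * hypercubeVec v i) :=
      Finset.sum_le_sum_of_subset_of_nonneg (Finset.subset_univ _)
        (fun _ _ _ => (Real.exp_pos _).le)
    calc Real.exp S ≤ n⁻¹ * (2 ^ d * Real.exp (S / 2)) :=
          h1.trans (by gcongr; exact h5.trans (h2.le.trans h3))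
      _ = _ := by ring
  have h6 : Real.exp (S / 2) ≤ 2 ^ d / n := by
    have : Real.exp S = Real.exp (S / 2) * Real.exp (S / 2) := by
      rw [← Real.exp_add]; ring_nf
    rw [this] at h4
    exact le_of_mul_le_mul_right h4 (Real.exp_pos _)
  have h7 := (Real.le_log_iff_exp_le (by positivity)).2 h6
  linarith
end

section
/- Let h₂(p) = −p·log₂ p − (1−p)·log₂(1−p) denote the binary entropy function (with the convention 0·log₂ 0 = 0). Then for every p ∈ [0, 1/2], (1 − 2p)² ≤ 2·(log 2)·(1 − h₂(p)). -/
open Real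

/-- The binary entropy function `h₂(p) = −p·log₂ p − (1−p)·log₂(1−p)`, with the
convention `0 · log₂ 0 = 0` (automatic in Lean since `Real.logb 2 0 = 0`). -/
noncomputable def binEntropy2 (p : ℝ) : ℝ :=
  -(p * Real.logb 2 p) - (1 - p) * Real.logb 2 (1 - p)

/-- The first-term bound of the artanh series: `2x ≤ log (1+x) - log (1-x)`. -/
lemma two_mul_le_log_sub_log (x : ℝ) (h0 : 0 ≤ x) (h1 : x < 1) :
    2 * x ≤ Real.log (1 + x) - Real.log (1 - x) := by
  have h := Real.hasSum_log_sub_log_of_abs_lt_one (x := x) (by rw [abs_of_nonneg h0]; exact h1)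
  have := le_hasSum h 0 (fun j _ => by positivity)
  simpa using this

/-- The natural-log version of the gap is decreasing on `[0, 1/2]`. -/
lemma gap_antitone :
    AntitoneOn (fun p : ℝ => -2 * Real.binEntropy p - (1 - 2 * p) ^ 2) (Set.Icc 0 (1 / 2)) := by
  apply antitoneOn_of_hasDerivWithinAt_nonpos (convex_Icc _ _)
    (f' := fun p => -2 * (Real.log (1 - p) - Real.log p) + 4 * (1 - 2 * p))
  · fun_prop
  · intro p hp
    rw [interior_Icc] at hp
    have h1 := (Real.hasDerivAt_binEntropy (p := p) hp.1.ne' (by linarith [hp.2])).const_mul (-2)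
    have h2 := (((hasDerivAt_id p).const_mul 2).const_sub 1).pow 2
    have h3 := h1.sub h2
    refine (h3.congr_deriv ?_).hasDerivWithinAt
    simp
    ring
  · intro p hp
    rw [interior_Icc] at hp
    obtain ⟨ha, hb⟩ := hp
    have h := two_mul_le_log_sub_log (1 - 2 * p) (by linarith) (by linarith)
    have e1 : 1 + (1 - 2 * p) = 2 * (1 - p) := by ring
    have e2 : 1 - (1 - 2 * p) = 2 * p := by ring
    rw [e1, e2, Real.log_mul (by norm_num) (by linarith), Real.log_mul (by norm_num) ha.ne'] at h
    linarith

/-- **Entropy inequality** (Lemma `h_2` in the paper): for every `p ∈ [0, 1/2]`,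
`(1 − 2p)² ≤ 2·(log 2)·(1 − h₂(p))`. -/
theorem sq_one_sub_two_mul_le_entropy_gap (p : ℝ) (hp0 : 0 ≤ p) (hp : p ≤ 1 / 2) :
    (1 - 2 * p) ^ 2 ≤ 2 * Real.log 2 * (1 - binEntropy2 p) := by
  have h := gap_antitone ⟨hp0, hp⟩ ⟨by norm_num, le_refl (1 / 2 : ℝ)⟩ hp
  have hl : Real.log 2 ≠ 0 := (Real.log_pos (by norm_num)).ne'
  have e : Real.log 2 * binEntropy2 p = Real.binEntropy p := by
    rw [binEntropy2, Real.binEntropy, Real.logb, Real.logb, Real.log_inv, Real.log_inv]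
    field_simp
    ring
  have e2 : Real.binEntropy (1 / 2) = Real.log 2 := by
    rw [one_div, Real.binEntropy_two_inv]
  simp only [e2] at h
  nlinarith
end

section
/- Let Y be a finite index set, k a natural number, and let (w_y)_{y ∈ Y} and (q_y)_{y ∈ Y} be families of real numbers with w_y ≥ 0, q_y ∈ (0, 1], ∑_{y ∈ Y} w_y = 2^k, and ∑_{y ∈ Y} w_y · q_y = 1. Then ∑_{y ∈ Y} w_y · q_y · log(2 / q_y) ≤ (k + 1) · log 2. -/
open Real Finset

/-- **Jensen step** (inequality \eqref{eq.jensen} in the paper): if nonnegative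
weights `(w_y)` sum to `2^k` and numbers `q_y ∈ (0,1]` satisfy `∑ w_y q_y = 1`,
then `∑ w_y q_y log(2/q_y) ≤ (k+1) log 2`. -/
theorem sum_weighted_entropy_le {Y : Type*} [Fintype Y] (k : ℕ)
    (w q : Y → ℝ)
    (hw : ∀ y, 0 ≤ w y)
    (hq0 : ∀ y, 0 < q y) (hq1 : ∀ y, q y ≤ 1)
    (hwsum : ∑ y, w y = 2 ^ k)
    (hwq : ∑ y, w y * q y = 1) :
    ∑ y, w y * q y * Real.log (2 / q y) ≤ (k + 1) * Real.log 2 := by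
  have key : ∀ y, w y * q y * Real.log (2 / q y)
      ≤ (w y * q y) * ((k + 1) * Real.log 2 - 1) + w y * (1 / 2 ^ k) := by
    intro y
    have hq := hq0 y
    have h2 : (0 : ℝ) < 2 ^ k := by positivity
    have h1 : Real.log (1 / (q y * 2 ^ k)) ≤ 1 / (q y * 2 ^ k) - 1 :=
      Real.log_le_sub_one_of_pos (by positivity)
    have h3 : Real.log (2 / q y) = (k + 1) * Real.log 2 + Real.log (1 / (q y * 2 ^ k)) := by
      rw [Real.log_div (by norm_num) hq.ne', Real.log_div one_ne_zero (by positivity),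
        Real.log_mul hq.ne' h2.ne', Real.log_pow, Real.log_one]
      ring
    have h4 : w y * (1 / 2 ^ k) = (w y * q y) * (1 / (q y * 2 ^ k)) := by
      field_simp
    rw [h4, ← mul_add]
    apply mul_le_mul_of_nonneg_left _ (mul_nonneg (hw y) hq.le)
    linarith
  calc _ ≤ ∑ y, ((w y * q y) * ((k + 1) * Real.log 2 - 1) + w y * (1 / 2 ^ k)) :=
        Finset.sum_le_sum fun y _ => key y
    _ = (k + 1) * Real.log 2 := by
        rw [Finset.sum_add_distrib, ← Finset.sum_mul, ← Finset.sum_mul, hwq, hwsum]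
        field_simp
        ring
end

section
/- Let U be uniformly distributed on the hypercube {−1,1}^d and let a = (a_1, …, a_d) and b = (b_1, …, b_d) be vectors in ℝ^d. Then E[ ( ∏_{i=1}^d (1 + U_i a_i) − 1 ) · ( ∏_{i=1}^d (1 + U_i b_i) − 1 ) ] = ∏_{i=1}^d (1 + a_i b_i) − 1. -/
open Real Finset

theorem sum_prod_hypercube {d : ℕ} (f : Fin d → Bool → ℝ) :
    ∑ u : Fin d → Bool, ∏ i, f i (u i) = ∏ i, (f i true + f i false) := by
  have h := Finset.prod_univ_sum (fun _ : Fin d => (Finset.univ : Finset Bool)) f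
  rw [Fintype.piFinset_univ] at h
  rw [← h]
  simp

/-- **Second-order statistic of the product Bernoulli likelihood ratio** (used in
the proof of Proposition `assumption` in the paper): for `U` uniform on `{−1,1}^d`
and vectors `a, b ∈ ℝ^d`,
`E[(∏ (1+Uᵢaᵢ) − 1)(∏ (1+Uᵢbᵢ) − 1)] = ∏ (1+aᵢbᵢ) − 1`. -/
theorem bernoulli_likelihood_ratio_second_order
    (d : ℕ) (a b : Fin d → ℝ) :
    (2 ^ d : ℝ)⁻¹ * ∑ u : Fin d → Bool,
        ((∏ i, (1 + hypercubeVec u i * a i)) - 1) *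
        ((∏ i, (1 + hypercubeVec u i * b i)) - 1)
      = (∏ i, (1 + a i * b i)) - 1 := by
  have hA : ∀ c : Fin d → ℝ,
      ∑ u : Fin d → Bool, ∏ i, (1 + hypercubeVec u i * c i) = 2 ^ d := by
    intro c
    have h := sum_prod_hypercube (fun i s => 1 + (if s then (1 : ℝ) else -1) * c i)
    unfold hypercubeVec
    rw [h]
    have h2 : ∀ i, (1 + (if true = true then (1 : ℝ) else -1) * c i)
        + (1 + (if false = true then (1 : ℝ) else -1) * c i) = 2 := by
      intro i
      simp
      ring
    rw [Finset.prod_congr rfl (fun i _ => h2 i)]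
    simp
  have hAB : ∑ u : Fin d → Bool, ∏ i, ((1 + hypercubeVec u i * a i) *
      (1 + hypercubeVec u i * b i)) = 2 ^ d * ∏ i, (1 + a i * b i) := by
    have h := sum_prod_hypercube (fun i s => (1 + (if s then (1 : ℝ) else -1) * a i) *
      (1 + (if s then (1 : ℝ) else -1) * b i))
    unfold hypercubeVec
    rw [h]
    have h2 : ∀ i, (1 + (if true = true then (1 : ℝ) else -1) * a i) *
        (1 + (if true = true then (1 : ℝ) else -1) * b i)
        + (1 + (if false = true then (1 : ℝ) else -1) * a i) *
        (1 + (if false = true then (1 : ℝ) else -1) * b i) = 2 * (1 + a i * b i) := by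
      intro i
      simp
      ring
    rw [Finset.prod_congr rfl (fun i _ => h2 i), Finset.prod_mul_distrib]
    simp
  have hE : ∀ x y : ℝ, (x - 1) * (y - 1) = x * y - x - y + 1 := by
    intro x y
    ring
  simp only [hE, Finset.sum_add_distrib, Finset.sum_sub_distrib, ← Finset.prod_mul_distrib,
    hA, hAB]
  have h1 : ∑ _u : Fin d → Bool, (1 : ℝ) = 2 ^ d := by simp
  rw [h1]
  field_simp
  ring
end
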